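/- arXiv:1512.09096 — 2 statements merged into one kernel-verified Lean document; each statement's English description precedes it below -/
import Mathlib

section
/- Let F be a field of characteristic 0 and let S, X be upper triangular n×n matrices over F with [S,X] = μX for some μ ≠ 0 in F. Then S is diagonalizable over F if and only if S − X is diagonalizable over F. -/
/-- A square matrix is *diagonalizable* over `F` if it is similar over `F` to a diagonal
matrix. -/
def Matrix.IsDiagonalizable {F : Type*} [Field F] {n : ℕ}
    (A : Matrix (Fin n) (Fin n) F) : Prop :=
  ∃ (P : GL (Fin n) F) (d : Fin n → F),
    A = (P : Matrix (Fin n) (Fin n) F) * Matrix.diagonal d * ((P⁻¹ : GL (Fin n) F) : Matrix (Fin n) (Fin n) F)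

theorem aux_diag {F : Type*} [Field F] {n : ℕ} (S X : Matrix (Fin n) (Fin n) F)
    (hS : S.BlockTriangular (id : Fin n → Fin n))
    (hX : X.BlockTriangular (id : Fin n → Fin n)) (i : Fin n) :
    (S * X) i i = S i i * X i i := by
  rw [Matrix.mul_apply, Finset.sum_eq_single i]
  · intro j _ hj
    rcases lt_or_gt_of_ne hj with h | h
    · rw [hS (show id j < id i from h), zero_mul]
    · rw [hX (show id i < id j from h), mul_zero]
  · simp

theorem aux_nil {F : Type*} [Field F] {n : ℕ} (S X : Matrix (Fin n) (Fin n) F)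
    (hS : S.BlockTriangular (id : Fin n → Fin n))
    (hX : X.BlockTriangular (id : Fin n → Fin n))
    (mu : F) (hmu : mu ≠ 0) (hadX : ⁅S, X⁆ = mu • X) : X ^ n = 0 := by
  have hd : ∀ i, X i i = 0 := by
    intro i
    have h := congrFun (congrFun hadX i) i
    rw [Ring.lie_def, Matrix.sub_apply, aux_diag S X hS hX, aux_diag X S hX hS,
      Matrix.smul_apply, smul_eq_mul, mul_comm, sub_self] at h
    exact (mul_eq_zero.mp h.symm).resolve_left hmu
  have h := Matrix.aeval_self_charpoly X
  rw [Matrix.charpoly_of_upperTriangular X hX] at h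
  simpa [hd] using h

theorem aux_comm {F : Type*} [Field F] {n : ℕ} (S Y : Matrix (Fin n) (Fin n) F)
    (mu : F) (h : S * Y = Y * S + mu • Y) (k : ℕ) :
    S * Y ^ k = Y ^ k * S + ((k : F) * mu) • Y ^ k := by
  induction k with
  | zero => simp
  | succ k ih =>
    rw [pow_succ, ← mul_assoc, ih, add_mul, mul_assoc, h, mul_add, smul_mul_assoc,
      mul_smul_comm, mul_assoc, add_assoc, ← add_smul]
    push_cast
    congr 2
    ring

theorem aux_exp {F : Type*} [Field F] [CharZero F] {n : ℕ} (S Y : Matrix (Fin n) (Fin n) F)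
    (mu : F) (h : S * Y = Y * S + mu • Y) (hY : Y ^ n = 0) :
    S * IsNilpotent.exp Y = IsNilpotent.exp Y * S + mu • (Y * IsNilpotent.exp Y) := by
  have hY' : Y ^ (n + 1) = 0 := by rw [pow_succ, hY, zero_mul]
  have e1 := IsNilpotent.exp_eq_sum (A := Matrix (Fin n) (Fin n) F) hY
  have e2 := IsNilpotent.exp_eq_sum (A := Matrix (Fin n) (Fin n) F) hY'
  have e3 : S * IsNilpotent.exp Y = IsNilpotent.exp Y * S +
      ∑ k ∈ Finset.range (n + 1), ((k.factorial : ℚ)⁻¹) • (((k : F) * mu) • Y ^ k) := by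
    rw [e2, Finset.mul_sum, Finset.sum_mul, ← Finset.sum_add_distrib]
    refine Finset.sum_congr rfl fun k _ => ?_
    rw [mul_smul_comm, smul_mul_assoc, aux_comm S Y mu h, smul_add]
  rw [e3, Finset.sum_range_succ']
  congr 1
  rw [e1, Finset.mul_sum, Finset.smul_sum]
  simp only [Nat.cast_zero, zero_mul, zero_smul, smul_zero, add_zero]
  refine Finset.sum_congr rfl fun k _ => ?_
  rw [mul_smul_comm, ← pow_succ']
  ext i j
  simp only [Matrix.smul_apply, Rat.smul_def, smul_eq_mul]
  have : (k.factorial : F) ≠ 0 := by exact_mod_cast k.factorial_ne_zero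
  have : (k : F) + 1 ≠ 0 := by exact_mod_cast k.succ_ne_zero
  rw [Nat.factorial_succ]
  push_cast
  field_simp

theorem aux_conj {F : Type*} [Field F] {n : ℕ} (A B : Matrix (Fin n) (Fin n) F)
    (U : GL (Fin n) F) (h : B * (U : Matrix (Fin n) (Fin n) F) = U * A)
    (hA : A.IsDiagonalizable) : B.IsDiagonalizable := by
  obtain ⟨P, d, rfl⟩ := hA
  refine ⟨U * P, d, ?_⟩
  rw [mul_inv_rev, Units.val_mul, Units.val_mul]
  have h2 : B = B * (U : Matrix (Fin n) (Fin n) F) *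
    ((U⁻¹ : GL (Fin n) F) : Matrix (Fin n) (Fin n) F) := by
    rw [Units.mul_inv_cancel_right]
  rw [h2, h]
  simp only [mul_assoc]

/-- If `S, X` are upper triangular matrices over a field `F` of characteristic `0` with
`[S, X] = μ • X` for some `μ ≠ 0`, then `S` is diagonalizable over `F` if and only if
`S - X` is diagonalizable over `F`. -/
theorem isDiagonalizable_sub_iff
    {F : Type*} [Field F] [CharZero F] {n : ℕ}
    (S X : Matrix (Fin n) (Fin n) F)
    (hS : S.BlockTriangular (id : Fin n → Fin n))
    (hX : X.BlockTriangular (id : Fin n → Fin n))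
    (mu : F) (hmu : mu ≠ 0) (hadX : ⁅S, X⁆ = mu • X) :
    S.IsDiagonalizable ↔ (S - X).IsDiagonalizable := by
  have hX0 := aux_nil S X hS hX mu hmu hadX
  have hY0 : (mu⁻¹ • X) ^ n = 0 := by rw [smul_pow, hX0, smul_zero]
  have hY : S * (mu⁻¹ • X) = (mu⁻¹ • X) * S + mu • (mu⁻¹ • X) := by
    rw [Ring.lie_def, sub_eq_iff_eq_add'] at hadX
    rw [mul_smul_comm, hadX, smul_add, smul_mul_assoc, smul_comm]
  have key := aux_exp S (mu⁻¹ • X) mu hY hY0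
  have hn : IsNilpotent (mu⁻¹ • X) := ⟨n, hY0⟩
  let U : GL (Fin n) F := ⟨IsNilpotent.exp (mu⁻¹ • X), IsNilpotent.exp (-(mu⁻¹ • X)),
    IsNilpotent.exp_mul_exp_neg_self hn, IsNilpotent.exp_neg_mul_exp_self hn⟩
  have hU : (S - X) * (U : Matrix (Fin n) (Fin n) F) = U * S := by
    change (S - X) * IsNilpotent.exp (mu⁻¹ • X) = IsNilpotent.exp (mu⁻¹ • X) * S
    rw [← smul_mul_assoc, smul_inv_smul₀ hmu] at key
    rw [sub_mul, key, add_sub_cancel_right]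
  refine ⟨aux_conj _ _ U hU, aux_conj _ _ U⁻¹ ?_⟩
  rw [Units.eq_inv_mul_iff_mul_eq, ← mul_assoc, ← hU, Units.mul_inv_cancel_right]
end

section
/- Let F be a field of characteristic 0, let t denote the Lie algebra of upper triangular n×n matrices over F, and let A ∈ t. Then A is diagonalizable over F if and only if the linear operator ad_t(A) : t → t, Y ↦ [A,Y], is diagonalizable over F. -/
/-- The space of upper triangular `n × n` matrices over `F`, as a submodule of all matrices. -/
def upperTriangularMatrices (F : Type*) [Field F] (n : ℕ) :
    Submodule F (Matrix (Fin n) (Fin n) F) where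
  carrier := {A | A.BlockTriangular (id : Fin n → Fin n)}
  add_mem' := fun ha hb => ha.add hb
  zero_mem' := Matrix.blockTriangular_zero
  smul_mem' := fun c _ hA i j hij => by
    simp [Matrix.smul_apply, hA hij]

/-- An endomorphism of a vector space is *diagonalizable* if the space is spanned by its
eigenvectors, i.e. the supremum of its eigenspaces is the whole space. -/
def Module.End.IsDiagonalizable {F V : Type*} [Field F] [AddCommGroup V] [Module F V]
    (f : Module.End F V) : Prop :=
  (⨆ μ : F, f.eigenspace μ) = ⊤

open Polynomial in
theorem aux_iSup_of_prod {F V : Type*} [Field F] [AddCommGroup V] [Module F V]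
    (g : Module.End F V) (s : Finset F) :
    LinearMap.ker (aeval g (∏ μ ∈ s, (X - C μ))) ≤ ⨆ μ : F, g.eigenspace μ := by
  classical
  induction s using Finset.induction_on with
  | empty => simp [Module.End.one_eq_id]
  | insert a s ha ih =>
    rw [Finset.prod_insert ha, ← sup_ker_aeval_eq_ker_aeval_mul_of_coprime]
    · refine sup_le ?_ ih
      refine le_trans (le_of_eq ?_) (le_iSup _ a)
      rw [Module.End.eigenspace_def]
      simp [Algebra.algebraMap_eq_smul_one]
    · refine IsCoprime.prod_right fun i hi => ?_
      exact isCoprime_X_sub_C_of_isUnit_sub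
        (sub_ne_zero.2 (fun h : a = i => ha (h ▸ hi))).isUnit

open Polynomial in
theorem aux_iSup_of_splits {F V : Type*} [Field F] [AddCommGroup V] [Module F V]
    (g : Module.End F V) (p : F[X]) (hs : p.Splits) (hm : p.Monic) (hsq : Squarefree p)
    (hp : aeval g p = 0) : ⨆ μ : F, g.eigenspace μ = ⊤ := by
  classical
  have hnd : p.roots.Nodup := by
    rw [Multiset.nodup_iff_count_le_one]
    intro a
    rw [count_roots]
    have := (squarefree_iff_emultiplicity_le_one p).1 hsq (X - C a)
    by_contra hlt
    push Not at hlt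
    have h2 : (X - C a) ^ 2 ∣ p := (le_rootMultiplicity_iff hm.ne_zero).1 hlt
    have := hsq (X - C a) (by rwa [← sq])
    exact not_isUnit_X_sub_C a this
  have hpe : p = ∏ μ ∈ p.roots.toFinset, (X - C μ) := by
    conv_lhs => rw [hs.eq_prod_roots_of_monic hm]
    rw [Finset.prod_multiset_map_count]
    refine Finset.prod_congr rfl fun x hx => ?_
    rw [Multiset.count_eq_one_of_mem hnd (Multiset.mem_toFinset.1 hx), pow_one]
  have := aux_iSup_of_prod g p.roots.toFinset
  rw [← hpe, hp, LinearMap.ker_zero] at this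
  exact top_le_iff.1 this

open Polynomial in
theorem aux_semisimple {F V : Type*} [Field F] [AddCommGroup V] [Module F V]
    [FiniteDimensional F V]
    (g : Module.End F V) (h : ⨆ μ : F, g.eigenspace μ = ⊤) : g.IsSemisimple := by
  classical
  have hfin : Set.Finite {μ | g.HasEigenvalue μ} := Module.End.finite_hasEigenvalue g
  refine Module.End.isSemisimple_of_squarefree_aeval_eq_zero
    (p := ∏ μ ∈ hfin.toFinset, (X - C μ)) ?_ ?_
  · exact (separable_prod_X_sub_C_iff' (f := fun x : F => x)).2 (fun x _ y _ h => h) |>.squarefree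
  · rw [← LinearMap.ker_eq_top, ← top_le_iff, ← h]
    refine iSup_le fun μ v hv => ?_
    by_cases h0 : g.HasEigenvalue μ
    · rw [LinearMap.mem_ker, Module.End.aeval_apply_of_mem_apply_eq_smul
        (Module.End.mem_eigenspace_iff.1 hv)]
      rw [eval_prod, Finset.prod_eq_zero (hfin.mem_toFinset.2 h0) (by simp), zero_smul]
    · have : g.eigenspace μ = ⊥ := by
        by_contra h1
        exact h0 (Module.End.hasEigenvalue_iff.2 h1)
      rw [this, Submodule.mem_bot] at hv
      simp [hv]

theorem aux_matrix_diag {F : Type*} [Field F] {n : ℕ} (A : Matrix (Fin n) (Fin n) F)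
    (h : ⨆ μ : F, Module.End.eigenspace (Matrix.toLin' A) μ = ⊤) : A.IsDiagonalizable := by
  classical
  let s : Set (Fin n → F) := {v | ∃ μ : F, A.mulVec v = μ • v}
  have hs : ⊤ ≤ Submodule.span F s := by
    rw [← h]
    refine iSup_le fun μ v hv => Submodule.subset_span ⟨μ, ?_⟩
    simpa using Module.End.mem_eigenspace_iff.1 hv
  let b0 := Module.Basis.ofSpan hs
  have hb0 : ∀ i, b0 i ∈ s := fun i => Module.Basis.ofSpan_subset hs ⟨i, rfl⟩
  have := Module.Basis.indexEquiv b0 (Pi.basisFun F (Fin n))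
  let b := b0.reindex this
  have hb : ∀ i, b i ∈ s := fun i => by simpa [b] using hb0 _
  choose d hd using hb
  let Q := (Pi.basisFun F (Fin n)).toMatrix b
  let R := b.toMatrix (Pi.basisFun F (Fin n))
  have h1 : Q * R = 1 := Module.Basis.toMatrix_mul_toMatrix_flip _ _
  have h2 : R * Q = 1 := Module.Basis.toMatrix_mul_toMatrix_flip _ _
  refine ⟨⟨Q, R, h1, h2⟩, d, ?_⟩
  change A = Q * Matrix.diagonal d * R
  have h3 : A * Q = Q * Matrix.diagonal d := by
    ext i j
    rw [Matrix.mul_diagonal]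
    have := congrFun (hd j) i
    simp only [Q, Matrix.mul_apply, Module.Basis.toMatrix_apply, Pi.basisFun_repr]
    simpa [Matrix.mulVec, dotProduct, mul_comm] using this
  rw [← h3, mul_assoc, h1, mul_one]

open Polynomial in
theorem aux_mulRight {F R : Type*} [Field F] [Ring R] [Algebra F R] (S : R) (p : F[X]) :
    aeval (LinearMap.mulRight F S) p = LinearMap.mulRight F (aeval S p) := by
  induction p using Polynomial.induction_on' with
  | add p q hp hq => ext x; simp [hp, hq, mul_add]
  | monomial k a =>
    ext x
    simp [aeval_monomial, LinearMap.pow_mulRight, Algebra.algebraMap_eq_smul_one]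

open Polynomial in
theorem aux_mulLeft {F R : Type*} [Field F] [Ring R] [Algebra F R] (S : R) (p : F[X]) :
    aeval (LinearMap.mulLeft F S) p = LinearMap.mulLeft F (aeval S p) := by
  induction p using Polynomial.induction_on' with
  | add p q hp hq => ext x; simp [hp, hq, add_mul]
  | monomial k a =>
    ext x
    simp [aeval_monomial, LinearMap.pow_mulLeft, Algebra.algebraMap_eq_smul_one]

open Polynomial in
theorem aux_aeval_tri {F : Type*} [Field F] {n : ℕ} (A : Matrix (Fin n) (Fin n) F)
    (hA : A.BlockTriangular (id : Fin n → Fin n)) (p : F[X]) :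
    (aeval A p).BlockTriangular (id : Fin n → Fin n) := by
  have hpow : ∀ k : ℕ, (A ^ k).BlockTriangular (id : Fin n → Fin n) := by
    intro k
    induction k with
    | zero => simpa using Matrix.blockTriangular_one
    | succ k ih => rw [pow_succ]; exact ih.mul hA
  induction p using Polynomial.induction_on' with
  | add p q hp hq => rw [map_add]; exact hp.add hq
  | monomial k a =>
    rw [aeval_monomial, ← Algebra.smul_def]
    exact (upperTriangularMatrices F n).smul_mem a (hpow k)

/-- The commutator with `A` on all matrices. -/
def auxAd {F : Type*} [Field F] {n : ℕ} (A : Matrix (Fin n) (Fin n) F) :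
    Module.End F (Matrix (Fin n) (Fin n) F) :=
  LinearMap.mulLeft F A - LinearMap.mulRight F A

theorem auxAd_mem {F : Type*} [Field F] {n : ℕ} {A : Matrix (Fin n) (Fin n) F}
    (hA : A.BlockTriangular (id : Fin n → Fin n)) :
    ∀ x ∈ upperTriangularMatrices F n, auxAd A x ∈ upperTriangularMatrices F n := by
  intro x hx
  exact Submodule.sub_mem _ (hA.mul hx) (Matrix.BlockTriangular.mul hx hA)

theorem aux_forward {F : Type*} [Field F] {n : ℕ} (A : Matrix (Fin n) (Fin n) F)
    (h : A.IsDiagonalizable) : ⨆ μ : F, (auxAd A).eigenspace μ = ⊤ := by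
  classical
  obtain ⟨P, d, hP⟩ := h
  have h1 : (P⁻¹ : GL (Fin n) F).val * P.val = 1 := by simp
  have h2 : P.val * (P⁻¹ : GL (Fin n) F).val = 1 := by simp
  generalize (P⁻¹ : GL (Fin n) F).val = R at *
  generalize P.val = Q at *
  have key : ∀ Z : Matrix (Fin n) (Fin n) F,
      Q * Z * R ∈ ⨆ μ : F, (auxAd A).eigenspace μ := by
    intro Z
    induction Z using Matrix.induction_on' with
    | h_zero => simp
    | h_add p q hp hq => rw [mul_add, add_mul]; exact Submodule.add_mem _ hp hq
    | h_std_basis i j x =>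
      refine Submodule.mem_iSup_of_mem (d i - d j) ?_
      rw [Module.End.mem_eigenspace_iff]
      have e1 : A * (Q * Matrix.single i j x * R) =
          Q * (Matrix.diagonal d * Matrix.single i j x) * R := by
        rw [hP]
        calc _ = Q * Matrix.diagonal d * (R * Q) * Matrix.single i j x * R := by
              simp only [mul_assoc]
          _ = _ := by rw [h1]; simp only [mul_assoc, mul_one]
      have e2 : (Q * Matrix.single i j x * R) * A =
          Q * (Matrix.single i j x * Matrix.diagonal d) * R := by
        rw [hP]
        calc _ = Q * Matrix.single i j x * (R * Q) * Matrix.diagonal d * R := by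
              simp only [mul_assoc]
          _ = _ := by rw [h1]; simp only [mul_assoc, mul_one]
      have e3 : Matrix.diagonal d * Matrix.single i j x - Matrix.single i j x * Matrix.diagonal d
          = (d i - d j) • Matrix.single i j x := by
        ext a b
        rw [Matrix.sub_apply, Matrix.diagonal_mul, Matrix.mul_diagonal, Matrix.smul_apply,
          Matrix.single_apply]
        split_ifs with hab
        · rw [← hab.1, ← hab.2, smul_eq_mul]; ring
        · simp
      change A * (Q * Matrix.single i j x * R) - (Q * Matrix.single i j x * R) * A = _
      rw [e1, e2, ← sub_mul, ← mul_sub, e3, Matrix.mul_smul, Matrix.smul_mul]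
  rw [eq_top_iff]
  intro X _
  have := key (R * X * Q)
  have e : Q * (R * X * Q) * R = X := by
    calc _ = (Q * R) * X * (Q * R) := by simp only [mul_assoc]
      _ = X := by rw [h2]; simp
  rwa [e] at this

theorem aux_nil_s5 {F : Type*} [Field F] {n : ℕ} (N : Matrix (Fin n) (Fin n) F)
    (hN : IsNilpotent N)
    (hc : ∀ Y : Matrix (Fin n) (Fin n) F, Y.BlockTriangular (id : Fin n → Fin n) →
      N * Y = Y * N) : N = 0 := by
  classical
  have hd : N = Matrix.diagonal (fun i => N i i) := by
    ext i j
    by_cases hij : i = j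
    · subst hij; simp
    · rw [Matrix.diagonal_apply_ne _ hij]
      have := congrFun (congrFun (hc (Matrix.diagonal (Pi.single i 1))
        (Matrix.blockTriangular_diagonal _)) i) j
      rw [Matrix.mul_diagonal, Matrix.diagonal_mul] at this
      simpa [Pi.single_apply, Ne.symm hij] using this.symm
  obtain ⟨k, hk⟩ := hN
  rw [hd, Matrix.diagonal_pow] at hk
  have hk' := Matrix.diagonal_eq_zero.1 hk
  rw [hd, Matrix.diagonal_eq_zero]
  funext i
  exact eq_zero_of_pow_eq_zero (congrFun hk' i)

open Polynomial in
theorem aux_backward {F : Type*} [Field F] [CharZero F] {n : ℕ}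
    (A : Matrix (Fin n) (Fin n) F)
    (hA : A.BlockTriangular (id : Fin n → Fin n))
    (h : Module.End.IsSemisimple ((auxAd A).restrict (auxAd_mem hA))) : A.IsDiagonalizable := by
  classical
  obtain ⟨N', hN', S', hS', hnil, hss, hsum⟩ :=
    Module.End.exists_isNilpotent_isSemisimple (f := Matrix.toLinAlgEquiv' A)
  rw [Algebra.adjoin_singleton_eq_range_aeval] at hN' hS'
  obtain ⟨pN, rfl⟩ := hN'
  obtain ⟨pS, rfl⟩ := hS'
  have toφ : ∀ (B : Matrix (Fin n) (Fin n) F) (q : F[X]),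
      aeval (Matrix.toLinAlgEquiv' B) q = Matrix.toLinAlgEquiv' (aeval B q) := fun B q =>
    aeval_algHom_apply (Matrix.toLinAlgEquiv' (R := F) (n := Fin n)).toAlgHom B q
  simp only [AlgHom.toRingHom_eq_coe, RingHom.coe_coe, toφ] at hnil hss hsum
  set N := aeval A pN with hNdef
  set S := aeval A pS with hSdef
  have hsum' : A = N + S := by
    apply (Matrix.toLinAlgEquiv' (R := F) (n := Fin n)).injective
    rw [map_add]; exact hsum
  have hNt : N.BlockTriangular (id : Fin n → Fin n) := aux_aeval_tri A hA pN
  have hSt : S.BlockTriangular (id : Fin n → Fin n) := aux_aeval_tri A hA pS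
  have hnilN : IsNilpotent N := by
    obtain ⟨k, hk⟩ := hnil
    refine ⟨k, (Matrix.toLinAlgEquiv' (R := F) (n := Fin n)).injective ?_⟩
    rw [map_pow, hk, map_zero]
  have hminS : aeval S (minpoly F (Matrix.toLinAlgEquiv' S)) = 0 := by
    apply (Matrix.toLinAlgEquiv' (R := F) (n := Fin n)).injective
    rw [← toφ, minpoly.aeval, map_zero]
  have hadS : (auxAd S).IsSemisimple := by
    refine Module.End.IsSemisimple.sub_of_commute (LinearMap.commute_mulLeft_right S S) ?_ ?_
    · exact Module.End.isSemisimple_of_squarefree_aeval_eq_zero hss.minpoly_squarefree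
        (by rw [aux_mulLeft, hminS]; simp)
    · exact Module.End.isSemisimple_of_squarefree_aeval_eq_zero hss.minpoly_squarefree
        (by rw [aux_mulRight, hminS]; simp)
  have hadN : IsNilpotent (auxAd N) := by
    refine Commute.isNilpotent_sub (LinearMap.commute_mulLeft_right N N) ?_ ?_
    · rwa [LinearMap.isNilpotent_mulLeft_iff]
    · rwa [LinearMap.isNilpotent_mulRight_iff]
  have hcomm : Commute A S := by
    rw [hSdef]
    have : Commute (aeval A (X : F[X])) (aeval A pS) := (Commute.all X pS).map (aeval A)
    simpa using this
  let fS : Module.End F (upperTriangularMatrices F n) := (auxAd S).restrict (auxAd_mem hSt)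
  let fN : Module.End F (upperTriangularMatrices F n) := (auxAd N).restrict (auxAd_mem hNt)
  let fA : Module.End F (upperTriangularMatrices F n) := (auxAd A).restrict (auxAd_mem hA)
  have hfS : fS.IsSemisimple := Module.End.IsSemisimple.restrict (auxAd_mem hSt) hadS
  have hfN : IsNilpotent fN := Module.End.isNilpotent.restrict (auxAd_mem hNt) hadN
  have hfe : fN = fA - fS := by
    ext1 x
    apply Subtype.ext
    change N * x.1 - x.1 * N = (A * x.1 - x.1 * A) - (S * x.1 - x.1 * S)
    rw [hsum']; noncomm_ring
  have hfc : Commute fA fS := by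
    ext1 x
    apply Subtype.ext
    change A * (S * x.1 - x.1 * S) - (S * x.1 - x.1 * S) * A
      = S * (A * x.1 - x.1 * A) - (A * x.1 - x.1 * A) * S
    have e := hcomm.eq
    have e1 : A * (S * x.1) = S * (A * x.1) := by rw [← mul_assoc, e, mul_assoc]
    have e2 : x.1 * S * A = x.1 * A * S := by rw [mul_assoc, ← e, mul_assoc]
    simp only [mul_sub, sub_mul, e1, e2, ← mul_assoc]
    simp only [mul_assoc]
    abel
  have hfNs : fN.IsSemisimple := by
    rw [hfe]; exact Module.End.IsSemisimple.sub_of_commute hfc h hfS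
  have hfN0 : fN = 0 := Module.End.eq_zero_of_isNilpotent_isSemisimple hfN hfNs
  have hN0 : N = 0 := by
    refine aux_nil_s5 N hnilN fun Y hY => ?_
    have := congrArg Subtype.val (LinearMap.congr_fun hfN0 ⟨Y, hY⟩)
    exact sub_eq_zero.1 this
  have hAS : A = S := by rw [hsum', hN0, zero_add]
  rw [← hAS] at hss
  have hsp : (minpoly F (Matrix.toLinAlgEquiv' A)).Splits := by
    have hc : A.charpoly.Splits := by
      rw [Matrix.charpoly_of_isUpperTriangular A hA]
      exact Splits.prod fun i _ => Splits.X_sub_C _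
    refine hc.of_dvd (Matrix.charpoly_monic A).ne_zero ?_
    apply minpoly.dvd
    rw [toφ, Matrix.aeval_self_charpoly, map_zero]
  exact aux_matrix_diag A (aux_iSup_of_splits _ _ hsp
    (minpoly.monic (Algebra.IsIntegral.isIntegral _)) hss.minpoly_squarefree (minpoly.aeval _ _))

/-- Let `t` be the Lie algebra of upper triangular `n × n` matrices over a field `F` of
characteristic `0`, and let `A ∈ t`.  Then the matrix `A` is diagonalizable over `F` if and
only if the operator `ad_t(A) : t → t`, `Y ↦ [A, Y]`, is diagonalizable over `F`. -/
theorem isDiagonalizable_iff_ad_isDiagonalizable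
    {F : Type*} [Field F] [CharZero F] {n : ℕ}
    (A : Matrix (Fin n) (Fin n) F)
    (hA : A.BlockTriangular (id : Fin n → Fin n))
    (f : Module.End F (upperTriangularMatrices F n))
    (hf : ∀ Y : upperTriangularMatrices F n,
      (f Y : Matrix (Fin n) (Fin n) F) = ⁅A, (Y : Matrix (Fin n) (Fin n) F)⁆) :
    A.IsDiagonalizable ↔ f.IsDiagonalizable := by
  have hfe : f = (auxAd A).restrict (auxAd_mem hA) := by
    ext1 x
    apply Subtype.ext
    rw [hf]
    rfl
  constructor
  · intro h
    rw [hfe]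
    exact Module.End.genEigenspace_restrict_eq_top (auxAd_mem hA) (aux_forward A h)
  · intro h
    apply aux_backward A hA
    rw [← hfe]
    exact aux_semisimple f h
end
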